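/- arXiv:1801.01744 — 4 statements merged into one kernel-verified Lean document; each statement's English description precedes it below -/
import Mathlib

section
/- There exists a constant C > 0 such that for all integers g ≥ 2, Σ_{i=1}^{g−1} B'_i · B'_{g−i} ≤ C · B'_{g−1}, where B'_h = (2h−1)!·b_h for h ≥ 1. -/
open Finset Real

noncomputable section

/-- `b_g = ((2^(2g-1) - 1)/2^(2g-1)) · |B_{2g}|/(2g)!` for `g ≥ 1`, and `b_0 = 1`. -/
def bSeq (g : ℕ) : ℚ :=
  if g = 0 then 1
  else ((2 ^ (2 * g - 1) - 1) / 2 ^ (2 * g - 1)) * |bernoulli (2 * g)| /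
    (Nat.factorial (2 * g) : ℚ)

/-- The sequence `b_g` viewed as real numbers. -/
def bR (g : ℕ) : ℝ := (bSeq g : ℝ)

/-- `B'_h = (2h−1)!·b_h` for `h ≥ 1`, and `B'_0 = 0`. -/
def Bp (h : ℕ) : ℝ := if h = 0 then 0 else (Nat.factorial (2 * h - 1) : ℝ) * bR h

theorem Nat.factorial_mul_factorial_le_two_mul (a b : ℕ) :
    (a + 2).factorial * (b + 2).factorial ≤ 2 * (a + b + 2).factorial := by
  induction b with
  | zero => simp [mul_comm]
  | succ b ih =>
    have h : (a + (b + 1) + 2).factorial = (a + b + 3) * (a + b + 2).factorial :=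
      Nat.factorial_succ (a + b + 2)
    have h' : (b + 1 + 2).factorial = (b + 3) * (b + 2).factorial := Nat.factorial_succ (b + 2)
    rw [h, h']
    calc (a + 2).factorial * ((b + 3) * (b + 2).factorial)
        = (b + 3) * ((a + 2).factorial * (b + 2).factorial) := by ring
      _ ≤ (a + b + 3) * (2 * (a + b + 2).factorial) := Nat.mul_le_mul (by omega) ih
      _ = _ := by ring

theorem sum_odd_factorial_mul_odd_factorial_le (m : ℕ) :
    ∑ i ∈ Finset.Icc 1 (m + 1), (2 * i - 1).factorial * (2 * (m + 2 - i) - 1).factorial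
      ≤ 4 * (2 * m + 1).factorial := by
  have hterm : ∀ i ∈ Finset.Icc 1 (m + 1),
      (2 * i - 1).factorial * (2 * (m + 2 - i) - 1).factorial ≤
        (if i = 1 then (2 * m + 1).factorial else 0)
          + (if i = m + 1 then (2 * m + 1).factorial else 0) + 2 * (2 * m).factorial := by
    intro i hi
    rw [Finset.mem_Icc] at hi
    by_cases h1 : i = 1
    · subst h1
      have : 2 * (m + 2 - 1) - 1 = 2 * m + 1 := by omega
      rw [this, if_pos rfl]
      simp only [mul_one, Nat.reduceSub, Nat.factorial_one]
      omega
    by_cases h2 : i = m + 1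
    · subst h2
      have : 2 * (m + 1) - 1 = 2 * m + 1 := by omega
      have h' : 2 * (m + 2 - (m + 1)) - 1 = 1 := by omega
      rw [this, h', if_pos rfl]
      simp only [Nat.factorial_one]
      omega
    · have h := Nat.factorial_mul_factorial_le_two_mul (2 * i - 3) (2 * (m + 2 - i) - 3)
      rw [show 2 * i - 3 + 2 = 2 * i - 1 by omega,
        show 2 * (m + 2 - i) - 3 + 2 = 2 * (m + 2 - i) - 1 by omega,
        show 2 * i - 3 + (2 * (m + 2 - i) - 3) + 2 = 2 * m by omega] at h
      simpa [h1, h2] using h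
  refine (Finset.sum_le_sum hterm).trans ?_
  rw [Finset.sum_add_distrib, Finset.sum_add_distrib, Finset.sum_ite_eq', Finset.sum_ite_eq',
    if_pos (by simp), if_pos (by simp), Finset.sum_const, Nat.card_Icc, Nat.factorial_succ (2 * m)]
  simp only [smul_eq_mul, Nat.add_sub_cancel]
  nlinarith [Nat.zero_le (m * (2 * m).factorial)]

/-- Euler's formula for `ζ(2k)`, with the sign absorbed by an absolute value. -/
theorem hasSum_zeta_nat_abs {k : ℕ} (hk : k ≠ 0) :
    HasSum (fun n : ℕ => 1 / (n : ℝ) ^ (2 * k))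
      (2 ^ (2 * k - 1) * π ^ (2 * k) * |(bernoulli (2 * k) : ℝ)| / (2 * k).factorial) := by
  have h := hasSum_zeta_nat hk
  have hnn := h.nonneg fun n => by positivity
  rw [← abs_of_nonneg hnn] at h
  simpa [abs_div, abs_mul, abs_of_pos Real.pi_pos] using h

theorem bR_bounds {k : ℕ} (hk : k ≠ 0) :
    ((1 / (2 * π)) ^ 2) ^ k ≤ bR k ∧ bR k ≤ 4 * ((1 / (2 * π)) ^ 2) ^ k := by
  have hz := hasSum_zeta_nat_abs hk
  set z : ℝ := 2 ^ (2 * k - 1) * π ^ (2 * k) * |(bernoulli (2 * k) : ℝ)| / (2 * k).factorial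
    with hzdef
  have h1 : 1 ≤ z := by
    simpa using le_hasSum hz 1 fun n _ => by positivity
  have h2 : z ≤ 2 := by
    have hle : z ≤ π ^ 2 / 6 := by
      refine hasSum_le (fun n => ?_) hz hasSum_zeta_two
      rcases Nat.eq_zero_or_pos n with rfl | hn
      · simp [hk]
      · have : (1 : ℝ) ≤ n := by exact_mod_cast hn
        gcongr
        omega
    nlinarith [Real.pi_lt_d2, Real.pi_pos]
  obtain ⟨j, rfl⟩ := Nat.exists_eq_succ_of_ne_zero hk
  have hb : bR (j + 1) = 2 * (1 - 1 / 2 ^ (2 * j + 1)) * z * ((1 / (2 * π)) ^ 2) ^ (j + 1) := by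
    have e : 2 * (j + 1) - 1 = 2 * j + 1 := by omega
    simp only [bR, bSeq, hzdef, Nat.succ_eq_add_one, e]
    push_cast
    rw [← pow_mul, div_pow, mul_pow, one_pow]
    have hπ := Real.pi_ne_zero
    field_simp
    ring
  have hp : (1 : ℝ) / 2 ^ (2 * j + 1) ≤ 1 / 2 := by
    gcongr
    exact le_self_pow₀ (by norm_num) (by omega)
  have hp0 : (0 : ℝ) ≤ 1 / 2 ^ (2 * j + 1) := by positivity
  have hq : 0 ≤ ((1 / (2 * π)) ^ 2) ^ (j + 1) := by positivity
  rw [Nat.succ_eq_add_one, hb]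
  constructor
  · refine le_mul_of_one_le_left hq ?_
    nlinarith
  · refine mul_le_mul_of_nonneg_right ?_ hq
    nlinarith

theorem stmt9 :
    ∃ C > (0 : ℝ), ∀ g : ℕ, 2 ≤ g →
      ∑ i ∈ Finset.Icc 1 (g - 1), Bp i * Bp (g - i) ≤ C * Bp (g - 1) := by
  have hq : (0 : ℝ) < (1 / (2 * π)) ^ 2 := by positivity
  have hb := @bR_bounds
  set q : ℝ := (1 / (2 * π)) ^ 2
  refine ⟨64 * q, by positivity, fun g hg => ?_⟩
  obtain ⟨m, rfl⟩ := Nat.exists_eq_add_of_le' hg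
  have hupper : ∀ k : ℕ, k ≠ 0 → 0 ≤ Bp k ∧ Bp k ≤ (2 * k - 1).factorial * (4 * q ^ k) := by
    intro k hk
    obtain ⟨hl, hu⟩ := hb hk
    have : 0 ≤ bR k := le_trans (by positivity) hl
    rw [Bp, if_neg hk]
    exact ⟨by positivity, by gcongr⟩
  have hlower : (2 * m + 1).factorial * q ^ (m + 1) ≤ Bp (m + 1) := by
    rw [Bp, if_neg m.succ_ne_zero, show 2 * (m + 1) - 1 = 2 * m + 1 by omega]
    gcongr
    exact (hb m.succ_ne_zero).1
  rw [show m + 2 - 1 = m + 1 by omega]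
  calc ∑ i ∈ Finset.Icc 1 (m + 1), Bp i * Bp (m + 2 - i)
      ≤ ∑ i ∈ Finset.Icc 1 (m + 1), 16 * q ^ (m + 2) *
          (((2 * i - 1).factorial * (2 * (m + 2 - i) - 1).factorial : ℕ) : ℝ) := by
        refine Finset.sum_le_sum fun i hi => ?_
        rw [Finset.mem_Icc] at hi
        obtain ⟨hi0, hiu⟩ := hupper i (by omega)
        obtain ⟨hj0, hju⟩ := hupper (m + 2 - i) (by omega)
        refine (mul_le_mul hiu hju hj0 (hi0.trans hiu)).trans_eq ?_
        have hpow : q ^ (m + 2) = q ^ i * q ^ (m + 2 - i) := by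
          rw [← pow_add]
          congr 1
          omega
        rw [hpow]
        push_cast
        ring
    _ ≤ 16 * q ^ (m + 2) * ((4 * (2 * m + 1).factorial : ℕ) : ℝ) := by
        rw [← Finset.mul_sum, ← Nat.cast_sum]
        gcongr
        exact sum_odd_factorial_mul_odd_factorial_le m
    _ = 64 * q * ((2 * m + 1).factorial * q ^ (m + 1)) := by
        push_cast
        ring
    _ ≤ 64 * q * Bp (m + 1) := by gcongr
end
end

section
/- There exists a constant C > 0 such that for all integers g ≥ k ≥ 2, Σ_{(g_1,…,g_k)} ∏_{j=1}^{k} B'_{g_j} ≤ C^{k−1} · B'_{g−k+1}, where the sum runs over all ordered k-tuples of positive integers with g_1 + ⋯ + g_k = g, and B'_h = (2h−1)!·b_h for h ≥ 1. -/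
open Finset Real

noncomputable section

/-- The even zeta value in absolute form: `|B_{2h}|/(2h)! = 2 ζ(2h) / (2π)^{2h}`, with
`1 ≤ ζ(2h) ≤ 2`. -/
theorem abs_bernoulli_div_factorial_bounds {h : ℕ} (hh : h ≠ 0) :
    2 * (((2 * π) ^ 2)⁻¹) ^ h ≤ |(bernoulli (2 * h) : ℝ)| / (Nat.factorial (2 * h) : ℝ) ∧
      |(bernoulli (2 * h) : ℝ)| / (Nat.factorial (2 * h) : ℝ) ≤ 4 * (((2 * π) ^ 2)⁻¹) ^ h := by
  have hz := hasSum_zeta_nat hh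
  set Z : ℝ := (-1 : ℝ) ^ (h + 1) * (2 : ℝ) ^ (2 * h - 1) * π ^ (2 * h) *
    bernoulli (2 * h) / (2 * h).factorial with hZ
  have one_le : 1 ≤ Z := by
    simpa using le_hasSum hz 1 (fun n _ => by positivity)
  have le_two : Z ≤ 2 := by
    have hle : Z ≤ π ^ 2 / 6 := by
      refine hasSum_le (fun n => ?_) hz hasSum_zeta_two
      rcases Nat.eq_zero_or_pos n with rfl | hn
      · simp [hh]
      · have hn1 : (1 : ℝ) ≤ n := by exact_mod_cast hn
        exact one_div_le_one_div_of_le (by positivity) (pow_le_pow_right₀ hn1 (by omega))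
    nlinarith [pi_lt_d2, pi_pos]
  have key : |(bernoulli (2 * h) : ℝ)| / (Nat.factorial (2 * h) : ℝ) =
      2 * Z * (((2 * π) ^ 2)⁻¹) ^ h := by
    have hZabs : Z = (2 : ℝ) ^ (2 * h - 1) * π ^ (2 * h) *
        |(bernoulli (2 * h) : ℝ)| / (2 * h).factorial := by
      rw [← abs_of_pos (zero_lt_one.trans_le one_le), hZ]
      simp [abs_mul, abs_div, abs_of_pos pi_pos]
    obtain ⟨m, rfl⟩ := Nat.exists_eq_succ_of_ne_zero hh
    have hsub : 2 * (m + 1) - 1 = 2 * m + 1 := by omega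
    have hpow : (((2 * π) ^ 2)⁻¹) ^ (m + 1) =
        (2 * (2 : ℝ) ^ (2 * m + 1) * π ^ (2 * (m + 1)))⁻¹ := by
      rw [inv_pow, ← pow_mul, mul_pow]
      congr 2
      ring
    rw [hZabs, Nat.succ_eq_add_one, hsub, hpow]
    have := pi_pos
    field_simp
  have hq : 0 ≤ (((2 * π) ^ 2)⁻¹) ^ h := by positivity
  rw [key]
  constructor <;> nlinarith

theorem bR_bounds_s10 {h : ℕ} (hh : h ≠ 0) :
    (((2 * π) ^ 2)⁻¹) ^ h ≤ bR h ∧ bR h ≤ 4 * (((2 * π) ^ 2)⁻¹) ^ h := by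
  obtain ⟨hl, hu⟩ := abs_bernoulli_div_factorial_bounds hh
  set t := |(bernoulli (2 * h) : ℝ)| / (Nat.factorial (2 * h) : ℝ) with ht
  have hb : bR h = (1 - ((2 : ℝ) ^ (2 * h - 1))⁻¹) * t := by
    simp only [bR, bSeq, if_neg hh, ht]
    push_cast
    field_simp
  have hpow : ((2 : ℝ) ^ (2 * h - 1))⁻¹ ≤ 1 / 2 := by
    rw [← one_div]
    refine one_div_le_one_div_of_le two_pos ?_
    exact le_self_pow₀ one_le_two (by omega)
  have hpos : 0 < ((2 : ℝ) ^ (2 * h - 1))⁻¹ := by positivity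
  have ht0 : 0 ≤ t := by positivity
  rw [hb]
  constructor <;> nlinarith

@[simp] theorem Bp_zero : Bp 0 = 0 := by simp [Bp]

theorem Bp_succ (n : ℕ) : Bp (n + 1) = (2 * n + 1).factorial * bR (n + 1) := by
  simp [Bp, show 2 * (n + 1) - 1 = 2 * n + 1 by omega]

theorem Bp_nonneg (n : ℕ) : 0 ≤ Bp n := by
  rcases n with _ | n
  · simp
  · rw [Bp_succ]
    exact mul_nonneg (by positivity) (le_trans (by positivity) (bR_bounds_s10 n.succ_ne_zero).1)

theorem factorial_add_three_mul_le (x y : ℕ) :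
    (x + 3).factorial * (y + 3).factorial ≤ 6 * (x + y + 3).factorial := by
  induction x with
  | zero => simp [Nat.factorial]
  | succ x ih =>
    rw [show x + 1 + 3 = (x + 3) + 1 by ring, show x + 1 + y + 3 = (x + y + 3) + 1 by ring,
      Nat.factorial_succ (x + 3), Nat.factorial_succ (x + y + 3)]
    calc (x + 3 + 1) * (x + 3).factorial * (y + 3).factorial
        = (x + 3 + 1) * ((x + 3).factorial * (y + 3).factorial) := by ring
      _ ≤ (x + y + 3 + 1) * (6 * (x + y + 3).factorial) :=
        Nat.mul_le_mul (by omega) ih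
      _ = _ := by ring

theorem sum_antidiagonal_odd_factorial_le (m : ℕ) :
    ∑ p ∈ antidiagonal m, (2 * p.1 + 1).factorial * (2 * p.2 + 1).factorial ≤
      8 * (2 * m + 1).factorial := by
  match m with
  | 0 => simp
  | 1 => decide
  | m + 2 =>
    have hin : ∑ p ∈ antidiagonal m,
        (2 * (p.1 + 1) + 1).factorial * (2 * (p.2 + 1) + 1).factorial ≤
          (m + 1) * (6 * (2 * m + 3).factorial) := by
      have := Finset.sum_le_card_nsmul (antidiagonal m)
        (fun p => (2 * (p.1 + 1) + 1).factorial * (2 * (p.2 + 1) + 1).factorial)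
        (6 * (2 * m + 3).factorial) (fun p hp => by
          have h := factorial_add_three_mul_le (2 * p.1) (2 * p.2)
          rw [HasAntidiagonal.mem_antidiagonal] at hp
          rwa [← mul_add, hp] at h)
      simpa using this
    have hfac : (m + 1) * (2 * m + 3).factorial ≤ (2 * (m + 2) + 1).factorial := by
      rw [show 2 * (m + 2) + 1 = (2 * m + 3) + 1 + 1 by ring, Nat.factorial_succ (2 * m + 3 + 1),
        Nat.factorial_succ (2 * m + 3), ← mul_assoc]
      exact Nat.mul_le_mul_right _ (by nlinarith)
    rw [Finset.Nat.antidiagonal_succ_succ']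
    simp only [sum_cons, sum_map, Function.Embedding.coe_prodMap, Function.Embedding.coeFn_mk,
      Prod.map, Nat.succ_eq_add_one, mul_zero, zero_add, Nat.factorial_one, one_mul, mul_one]
    linarith

/-- The two-factor case: self-convolution of `Bp` is controlled by the extreme terms. -/
theorem sum_antidiagonal_Bp_mul_le (n : ℕ) :
    ∑ p ∈ antidiagonal n, Bp p.1 * Bp p.2 ≤ 128 * Bp (n - 1) := by
  match n with
  | 0 => simp
  | 1 => simp [Finset.Nat.antidiagonal_succ]
  | m + 2 =>
    set q : ℝ := ((2 * π) ^ 2)⁻¹ with hq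
    have hq0 : 0 ≤ q := by positivity
    have hq1 : q ≤ 1 := inv_le_one_of_one_le₀ (by nlinarith [pi_gt_three])
    rw [Finset.Nat.antidiagonal_succ_succ']
    simp only [sum_cons, sum_map, Function.Embedding.coe_prodMap, Function.Embedding.coeFn_mk,
      Prod.map, Nat.succ_eq_add_one, Bp_zero, mul_zero, zero_mul, zero_add]
    calc ∑ p ∈ antidiagonal m, Bp (p.1 + 1) * Bp (p.2 + 1)
        ≤ ∑ p ∈ antidiagonal m, 16 * q ^ (m + 2) *
            (((2 * p.1 + 1).factorial * (2 * p.2 + 1).factorial : ℕ) : ℝ) := by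
          refine Finset.sum_le_sum fun p hp => ?_
          rw [HasAntidiagonal.mem_antidiagonal] at hp
          have h1 : Bp (p.1 + 1) ≤ (2 * p.1 + 1).factorial * (4 * q ^ (p.1 + 1)) := by
            rw [Bp_succ]
            exact mul_le_mul_of_nonneg_left (bR_bounds_s10 p.1.succ_ne_zero).2 (by positivity)
          have h2 : Bp (p.2 + 1) ≤ (2 * p.2 + 1).factorial * (4 * q ^ (p.2 + 1)) := by
            rw [Bp_succ]
            exact mul_le_mul_of_nonneg_left (bR_bounds_s10 p.2.succ_ne_zero).2 (by positivity)
          refine (mul_le_mul h1 h2 (Bp_nonneg _) (by positivity)).trans_eq ?_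
          rw [← hp]
          push_cast
          ring
      _ ≤ 16 * q ^ (m + 2) * (8 * (2 * m + 1).factorial) := by
          rw [← Finset.mul_sum]
          refine mul_le_mul_of_nonneg_left ?_ (by positivity)
          exact_mod_cast sum_antidiagonal_odd_factorial_le m
      _ = 128 * ((2 * m + 1).factorial * q ^ (m + 2)) := by ring
      _ ≤ 128 * ((2 * m + 1).factorial * q ^ (m + 1)) := by
          gcongr 128 * (_ * ?_)
          exact pow_le_pow_of_le_one hq0 hq1 (by omega)
      _ ≤ 128 * Bp (m + 2 - 1) := by
          rw [show m + 2 - 1 = m + 1 by omega, Bp_succ]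
          gcongr
          exact (bR_bounds_s10 m.succ_ne_zero).1

theorem sum_antidiagonal_Bp_mul_Bp_sub (g k : ℕ) :
    ∑ p ∈ antidiagonal g, Bp p.1 * Bp (p.2 - k) =
      ∑ p ∈ antidiagonal (g - k), Bp p.1 * Bp p.2 := by
  rw [Finset.Nat.sum_antidiagonal_eq_sum_range_succ (fun i j => Bp i * Bp (j - k)),
    Finset.Nat.sum_antidiagonal_eq_sum_range_succ (fun i j => Bp i * Bp j)]
  symm
  refine (Finset.sum_congr rfl fun i _ => by rw [Nat.sub_right_comm]).trans
    (Finset.sum_subset (Finset.range_mono (by omega)) fun i _ hi => ?_)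
  rw [Finset.mem_range] at hi
  rw [show g - i - k = 0 by omega, Bp_zero, mul_zero]

theorem sum_antidiagonalTuple_prod_Bp_le (k g : ℕ) :
    ∑ d ∈ Finset.Nat.antidiagonalTuple (k + 1) g, ∏ j, Bp (d j) ≤ 128 ^ k * Bp (g - k) := by
  induction k generalizing g with
  | zero => simp
  | succ k ih =>
    have hsplit : ∑ d ∈ Finset.Nat.antidiagonalTuple (k + 1 + 1) g, ∏ j, Bp (d j) =
        ∑ p ∈ antidiagonal g, Bp p.1 *
          ∑ d ∈ Finset.Nat.antidiagonalTuple (k + 1) p.2, ∏ j, Bp (d j) := by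
      simp_rw [Finset.mul_sum]
      rw [Finset.sum_sigma']
      refine Finset.sum_bij' (fun d _ => ⟨(d 0, ∑ j : Fin (k + 1), d j.succ), Fin.tail d⟩)
        (fun x _ => Fin.cons x.1.1 x.2) ?_ ?_ ?_ ?_ ?_
      · intro d hd
        simpa [Finset.Nat.mem_antidiagonalTuple, Fin.sum_univ_succ, Fin.tail] using hd
      · rintro ⟨⟨a, b⟩, d⟩ hd
        simp only [mem_sigma, HasAntidiagonal.mem_antidiagonal, Finset.Nat.mem_antidiagonalTuple] at hd
        rw [Finset.Nat.mem_antidiagonalTuple, Fin.sum_cons, hd.2, hd.1]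
      · intro d _
        exact Fin.cons_self_tail d
      · rintro ⟨⟨a, b⟩, d⟩ hd
        simp only [mem_sigma, HasAntidiagonal.mem_antidiagonal, Finset.Nat.mem_antidiagonalTuple] at hd
        simp [hd.2]
      · intro d _
        rw [Fin.prod_univ_succ]
        rfl
    calc _ = _ := hsplit
      _ ≤ ∑ p ∈ antidiagonal g, Bp p.1 * (128 ^ k * Bp (p.2 - k)) :=
        Finset.sum_le_sum fun p _ => mul_le_mul_of_nonneg_left (ih p.2) (Bp_nonneg _)
      _ = 128 ^ k * ∑ p ∈ antidiagonal (g - k), Bp p.1 * Bp p.2 := by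
        rw [← sum_antidiagonal_Bp_mul_Bp_sub, Finset.mul_sum]
        exact Finset.sum_congr rfl fun p _ => by ring
      _ ≤ 128 ^ k * (128 * Bp (g - k - 1)) := by
        gcongr
        exact sum_antidiagonal_Bp_mul_le _
      _ = 128 ^ (k + 1) * Bp (g - (k + 1)) := by
        rw [Nat.sub_sub, pow_succ, mul_assoc]

theorem stmt10 :
    ∃ C > (0 : ℝ), ∀ g k : ℕ, 2 ≤ k → k ≤ g →
      (∑ d ∈ (Finset.Nat.antidiagonalTuple k g).filter (fun d => ∀ j, 0 < d j),
        ∏ j, Bp (d j)) ≤ C ^ (k - 1) * Bp (g - k + 1) := by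
  refine ⟨128, by norm_num, fun g k hk hkg => ?_⟩
  have hall := sum_antidiagonalTuple_prod_Bp_le (k - 1) g
  rw [show k - 1 + 1 = k by omega, show g - (k - 1) = g - k + 1 by omega] at hall
  refine (Finset.sum_le_sum_of_subset_of_nonneg (Finset.filter_subset _ _) ?_).trans hall
  exact fun d _ _ => Finset.prod_nonneg fun j _ => Bp_nonneg _
end
end

section
/- Let (a_g)_{g≥1} and (d_g)_{g≥1} be sequences of positive real numbers such that (a_g) satisfies the volume recursion and (d_g) satisfies the Siegel–Veech recursion relative to (a_g). Then for every g ≥ 1, a_g ≤ (2g−2)!·b_g and 2·d_g ≤ (2g−2)!·b_{g−1}. -/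
open Finset Real

noncomputable section

/-- The sum over ordered `k`-tuples of positive integers with sum `g` of
`∏_j (2 d_j - 1) a_{d_j}`. -/
def tupleSum (a : ℕ → ℝ) (k g : ℕ) : ℝ :=
  ∑ d ∈ (Finset.Nat.antidiagonalTuple k g).filter (fun d => ∀ j, 0 < d j),
    ∏ j, ((2 * (d j : ℝ) - 1) * a (d j))

/-- The volume recursion for a sequence `(a_g)_{g ≥ 1}`:
`b_g = Σ_{k=1}^{g} (1/(k!·(2g−k)!)) · Σ_{d_1+⋯+d_k=g} ∏ (2d_j−1)·a_{d_j}`. -/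
def VolumeRecursion (a : ℕ → ℝ) : Prop :=
  ∀ g : ℕ, 1 ≤ g →
    bR g = ∑ k ∈ Finset.Icc 1 g,
      (1 / ((Nat.factorial k * Nat.factorial (2 * g - k) : ℕ) : ℝ)) * tupleSum a k g

/-- The Siegel–Veech recursion for `(d_g)_{g ≥ 1}` relative to `(a_g)_{g ≥ 1}`:
`b_{g−1}/2 = Σ_{g'=1}^{g} Σ_{k=0}^{g−g'} ((2g'−1)·d_{g'}/(k!·(2g−1−k)!)) ·
Σ_{g_1+⋯+g_k=g−g'} ∏ (2g_i−1)·a_{g_i}`. -/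
def SVRecursion (a d : ℕ → ℝ) : Prop :=
  ∀ g : ℕ, 1 ≤ g →
    bR (g - 1) / 2 =
      ∑ g' ∈ Finset.Icc 1 g, ∑ k ∈ Finset.range (g - g' + 1),
        ((2 * (g' : ℝ) - 1) * d g' /
          ((Nat.factorial k * Nat.factorial (2 * g - 1 - k) : ℕ) : ℝ)) *
          tupleSum a k (g - g')

theorem tupleSum_nonneg {a : ℕ → ℝ} (hapos : ∀ g : ℕ, 1 ≤ g → 0 < a g) (k g : ℕ) :
    0 ≤ tupleSum a k g := by
  refine Finset.sum_nonneg fun d hd => Finset.prod_nonneg fun j _ => ?_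
  have hj : 1 ≤ d j := (Finset.mem_filter.mp hd).2 j
  have hj' : (1 : ℝ) ≤ d j := by exact_mod_cast hj
  exact mul_nonneg (by linarith) (hapos _ hj).le

theorem tupleSum_zero_zero (a : ℕ → ℝ) : tupleSum a 0 0 = 1 := by
  simp [tupleSum]

theorem tupleSum_one (a : ℕ → ℝ) {g : ℕ} (hg : 1 ≤ g) :
    tupleSum a 1 g = (2 * (g : ℝ) - 1) * a g := by
  have hg' : 0 < g := hg
  simp [tupleSum, Finset.filter_singleton, hg']

theorem factorial_two_mul_sub_one {g : ℕ} (hg : 1 ≤ g) :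
    (Nat.factorial (2 * g - 1) : ℝ) = (2 * (g : ℝ) - 1) * Nat.factorial (2 * g - 2) := by
  obtain ⟨n, rfl⟩ := Nat.exists_eq_add_of_le' hg
  rw [show 2 * (n + 1) - 1 = 2 * n + 1 by omega, show 2 * (n + 1) - 2 = 2 * n by omega,
    Nat.factorial_succ]
  push_cast
  ring

theorem VolumeRecursion.le_factorial_mul {a : ℕ → ℝ} (hapos : ∀ g : ℕ, 1 ≤ g → 0 < a g)
    (ha : VolumeRecursion a) {g : ℕ} (hg : 1 ≤ g) :
    a g ≤ (Nat.factorial (2 * g - 2) : ℝ) * bR g := by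
  have hterm := Finset.single_le_sum
    (f := fun k => (1 / ((Nat.factorial k * Nat.factorial (2 * g - k) : ℕ) : ℝ)) * tupleSum a k g)
    (fun k _ => mul_nonneg (by positivity) (tupleSum_nonneg hapos k g))
    (Finset.mem_Icc.mpr ⟨le_rfl, hg⟩)
  rw [← ha g hg] at hterm
  have hg' : (1 : ℝ) ≤ g := by exact_mod_cast hg
  have hodd : 2 * (g : ℝ) - 1 ≠ 0 := by linarith
  have hfac : (0 : ℝ) < Nat.factorial (2 * g - 2) := by positivity
  rw [mul_comm, ← div_le_iff₀ hfac]
  refine le_of_eq_of_le ?_ hterm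
  simp only [Nat.factorial_one, one_mul, tupleSum_one a hg, factorial_two_mul_sub_one hg]
  field_simp

theorem SVRecursion.two_mul_le_factorial_mul {a d : ℕ → ℝ}
    (hapos : ∀ g : ℕ, 1 ≤ g → 0 < a g) (hdpos : ∀ g : ℕ, 1 ≤ g → 0 < d g)
    (hd : SVRecursion a d) {g : ℕ} (hg : 1 ≤ g) :
    2 * d g ≤ (Nat.factorial (2 * g - 2) : ℝ) * bR (g - 1) := by
  have hnonneg : ∀ g' ∈ Finset.Icc 1 g, ∀ k : ℕ,
      0 ≤ ((2 * (g' : ℝ) - 1) * d g' /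
        ((Nat.factorial k * Nat.factorial (2 * g - 1 - k) : ℕ) : ℝ)) *
          tupleSum a k (g - g') := by
    intro g' hmem k
    have h1 := (Finset.mem_Icc.mp hmem).1
    have h1' : (1 : ℝ) ≤ g' := by exact_mod_cast h1
    exact mul_nonneg (div_nonneg (mul_nonneg (by linarith) (hdpos g' h1).le) (by positivity))
      (tupleSum_nonneg hapos _ _)
  have hterm := Finset.single_le_sum
    (fun g' hmem => Finset.sum_nonneg (s := Finset.range (g - g' + 1))
      fun k _ => hnonneg g' hmem k)
    (Finset.mem_Icc.mpr ⟨hg, le_rfl⟩)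
  rw [← hd g hg] at hterm
  have hg' : (1 : ℝ) ≤ g := by exact_mod_cast hg
  have hodd : 2 * (g : ℝ) - 1 ≠ 0 := by linarith
  have hfac : (0 : ℝ) < Nat.factorial (2 * g - 2) := by positivity
  have hdiv : d g / (Nat.factorial (2 * g - 2) : ℝ) ≤ bR (g - 1) / 2 := by
    refine le_of_eq_of_le ?_ hterm
    simp only [Nat.sub_self, zero_add, Finset.sum_range_one, Nat.factorial_zero, one_mul,
      Nat.sub_zero, tupleSum_zero_zero, mul_one, factorial_two_mul_sub_one hg]
    field_simp
  rw [div_le_iff₀ hfac] at hdiv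
  linarith

theorem stmt11 (a d : ℕ → ℝ)
    (hapos : ∀ g : ℕ, 1 ≤ g → 0 < a g) (hdpos : ∀ g : ℕ, 1 ≤ g → 0 < d g)
    (ha : VolumeRecursion a) (hd : SVRecursion a d) (g : ℕ) (hg : 1 ≤ g) :
    a g ≤ (Nat.factorial (2 * g - 2) : ℝ) * bR g ∧
    2 * d g ≤ (Nat.factorial (2 * g - 2) : ℝ) * bR (g - 1) := by
  exact ⟨ha.le_factorial_mul hapos hg, hd.two_mul_le_factorial_mul hapos hdpos hg⟩
end
end

section
/- For every constant C > 0, one has Σ_{k=2}^{g} ((2g−2)!/(k!·(2g−k)!)) · C^{k−1} · B'_{g−k+1} = O((2g−2)!·b_g/g) as g → ∞, where B'_h = (2h−1)!·b_h; that is, there exist C' > 0 and g_0 such that for all g ≥ g_0, Σ_{k=2}^{g} ((2g−2)!/(k!·(2g−k)!)) · C^{k−1} · (2g−2k+1)!·b_{g−k+1} ≤ C'·(2g−2)!·b_g/g. -/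
open Finset Real

noncomputable section

/-- For `k ≥ 1`, `|B_{2k}|/(2k)!` scaled by `(2π)^{2k}/2` is `ζ(2k)`, hence lies in `[1, 2]`. -/
theorem scaled_abs_bernoulli_mem_Icc {k : ℕ} (hk : k ≠ 0) :
    2 ^ (2 * k - 1) * π ^ (2 * k) * |(bernoulli (2 * k) : ℝ)| / (Nat.factorial (2 * k) : ℝ)
      ∈ Set.Icc (1 : ℝ) 2 := by
  have hs := hasSum_zeta_nat hk
  set S : ℝ := (-1) ^ (k + 1) * 2 ^ (2 * k - 1) * π ^ (2 * k) * (bernoulli (2 * k) : ℝ) /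
    (Nat.factorial (2 * k) : ℝ) with hS
  have h1 : 1 ≤ S := by
    have := le_hasSum hs 1 (fun j _ => by positivity)
    simpa using this
  have h2 : S ≤ 2 := by
    have hle : S ≤ π ^ 2 / 6 := by
      refine hasSum_le (fun n => ?_) hs hasSum_zeta_two
      rcases Nat.eq_zero_or_pos n with rfl | hn
      · simp [hk]
      · have hn' : (1 : ℝ) ≤ n := by exact_mod_cast hn
        exact one_div_le_one_div_of_le (by positivity) (pow_le_pow_right₀ hn' (by omega))
    have := Real.pi_lt_d2
    have := Real.pi_pos
    nlinarith
  have habs : |S| = 2 ^ (2 * k - 1) * π ^ (2 * k) * |(bernoulli (2 * k) : ℝ)| /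
      (Nat.factorial (2 * k) : ℝ) := by
    rw [hS, abs_div, abs_mul, abs_mul, abs_mul, abs_pow, abs_neg, abs_one, one_pow, one_mul,
      abs_of_pos (by positivity : (0 : ℝ) < 2 ^ (2 * k - 1)),
      abs_of_pos (by positivity : (0 : ℝ) < π ^ (2 * k)), Nat.abs_cast]
  rw [← habs, abs_of_pos (by linarith)]
  exact ⟨h1, h2⟩

/-- The growth of `b_k`: one has `1 ≤ b_k (2π)^{2k} ≤ 4` for `k ≥ 1`. -/
theorem bR_mul_pow_mem_Icc {k : ℕ} (hk : k ≠ 0) :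
    bR k * ((2 * π) ^ 2) ^ k ∈ Set.Icc (1 : ℝ) 4 := by
  obtain ⟨h1, h2⟩ := scaled_abs_bernoulli_mem_Icc hk
  have heq : bR k * ((2 * π) ^ 2) ^ k = (2 - 2 / 2 ^ (2 * k - 1)) *
      (2 ^ (2 * k - 1) * π ^ (2 * k) * |(bernoulli (2 * k) : ℝ)| /
        (Nat.factorial (2 * k) : ℝ)) := by
    have hp : ((2 * π) ^ 2) ^ k = 2 * 2 ^ (2 * k - 1) * π ^ (2 * k) := by
      rw [← pow_mul, mul_pow, ← pow_succ', Nat.sub_add_cancel (by omega)]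
    rw [hp, bR, bSeq, if_neg hk]
    push_cast
    field_simp
  have hpow : (2 : ℝ) ≤ 2 ^ (2 * k - 1) := by
    simpa using pow_le_pow_right₀ (one_le_two (α := ℝ)) (by omega : 1 ≤ 2 * k - 1)
  have hle : (2 : ℝ) / 2 ^ (2 * k - 1) ≤ 1 := by
    rw [div_le_one (by positivity)]
    exact hpow
  have hnn : (0 : ℝ) ≤ 2 / 2 ^ (2 * k - 1) := by positivity
  rw [heq]
  constructor <;> nlinarith

theorem bR_pos {k : ℕ} (hk : k ≠ 0) : 0 < bR k :=
  pos_of_mul_pos_left (zero_lt_one.trans_le (bR_mul_pow_mem_Icc hk).1) (by positivity)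

theorem bR_le_mul_bR_add {h : ℕ} (hh : h ≠ 0) (m : ℕ) :
    bR h ≤ 4 * ((2 * π) ^ 2) ^ m * bR (h + m) := by
  have h1 := (bR_mul_pow_mem_Icc hh).2
  have h2 := (bR_mul_pow_mem_Icc (k := h + m) (by omega)).1
  refine le_of_mul_le_mul_right (a := ((2 * π) ^ 2) ^ h) ?_ (by positivity)
  calc bR h * ((2 * π) ^ 2) ^ h ≤ 4 * (bR (h + m) * ((2 * π) ^ 2) ^ (h + m)) := by linarith
    _ = 4 * ((2 * π) ^ 2) ^ m * bR (h + m) * ((2 * π) ^ 2) ^ h := by ring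

theorem mul_factorial_le_factorial {g k : ℕ} (hk : 2 ≤ k) (hkg : k ≤ g) :
    g * Nat.factorial (2 * g - 2 * k + 1) ≤ Nat.factorial (2 * g - k) := by
  obtain ⟨n, hn⟩ : ∃ n, 2 * g - k = n + 1 := ⟨2 * g - k - 1, by omega⟩
  rw [hn, Nat.factorial_succ n]
  exact Nat.mul_le_mul (by omega) (Nat.factorial_le (by omega))

theorem stmt14 (C : ℝ) (hC : 0 < C) :
    ∃ C' > (0 : ℝ), ∃ g0 : ℕ, ∀ g : ℕ, g0 ≤ g →
      ∑ k ∈ Finset.Icc 2 g,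
          ((Nat.factorial (2 * g - 2) : ℝ) /
            ((Nat.factorial k * Nat.factorial (2 * g - k) : ℕ) : ℝ)) *
            C ^ (k - 1) * (Nat.factorial (2 * g - 2 * k + 1) : ℝ) * bR (g - k + 1) ≤
        C' * ((Nat.factorial (2 * g - 2) : ℝ) * bR g) / (g : ℝ) := by
  set A : ℝ := C * (2 * π) ^ 2 with hA
  have hA0 : 0 < A := by positivity
  refine ⟨4 * Real.exp A, by positivity, 1, fun g hg => ?_⟩
  have hg0 : (0 : ℝ) < g := by exact_mod_cast hg
  have hb := bR_pos (k := g) (by omega)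
  have hterm : ∀ k ∈ Finset.Icc 2 g,
      ((Nat.factorial (2 * g - 2) : ℝ) /
        ((Nat.factorial k * Nat.factorial (2 * g - k) : ℕ) : ℝ)) *
        C ^ (k - 1) * (Nat.factorial (2 * g - 2 * k + 1) : ℝ) * bR (g - k + 1) ≤
      4 * ((Nat.factorial (2 * g - 2) : ℝ) * bR g) / g *
        (A ^ (k - 1) / (Nat.factorial (k - 1) : ℝ)) := by
    intro k hk
    obtain ⟨hk2, hkg⟩ := Finset.mem_Icc.mp hk
    have hbk := bR_le_mul_bR_add (h := g - k + 1) (by omega) (k - 1)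
    rw [show g - k + 1 + (k - 1) = g by omega] at hbk
    have hfac : (Nat.factorial (2 * g - 2 * k + 1) : ℝ) / (Nat.factorial (2 * g - k) : ℝ)
        ≤ 1 / g := by
      rw [div_le_div_iff₀ (by positivity) hg0, one_mul, mul_comm]
      exact_mod_cast mul_factorial_le_factorial hk2 hkg
    have hinv : 1 / (Nat.factorial k : ℝ) ≤ 1 / (Nat.factorial (k - 1) : ℝ) :=
      one_div_le_one_div_of_le (by positivity)
        (by exact_mod_cast Nat.factorial_le (Nat.sub_le k 1))
    calc _ = (Nat.factorial (2 * g - 2) : ℝ) * C ^ (k - 1) * (1 / (Nat.factorial k : ℝ)) *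
          ((Nat.factorial (2 * g - 2 * k + 1) : ℝ) / (Nat.factorial (2 * g - k) : ℝ)) *
          bR (g - k + 1) := by
          push_cast
          field_simp
      _ ≤ (Nat.factorial (2 * g - 2) : ℝ) * C ^ (k - 1) *
          (1 / (Nat.factorial (k - 1) : ℝ)) * (1 / g) *
          (4 * ((2 * π) ^ 2) ^ (k - 1) * bR g) := by
          have := (bR_pos (k := g - k + 1) (by omega)).le
          gcongr
      _ = _ := by
          rw [hA, mul_pow C]
          ring
  have hexp : ∑ k ∈ Finset.Icc 2 g, A ^ (k - 1) / (Nat.factorial (k - 1) : ℝ) ≤ Real.exp A := by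
    refine le_trans ?_ (Real.sum_le_exp_of_nonneg hA0.le g)
    rw [← Finset.sum_image (s := Finset.Icc 2 g) (g := fun k => k - 1)
      (f := fun i => A ^ i / (Nat.factorial i : ℝ))]
    · refine Finset.sum_le_sum_of_subset_of_nonneg ?_ (fun _ _ _ => by positivity)
      intro i hi
      obtain ⟨k, hk, rfl⟩ := Finset.mem_image.mp hi
      simp only [Finset.mem_Icc, Finset.mem_range] at hk ⊢
      omega
    · intro a ha b hb hab
      simp only [Finset.coe_Icc, Set.mem_Icc] at ha hb hab
      omega
  calc _ ≤ _ := Finset.sum_le_sum hterm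
    _ = 4 * ((Nat.factorial (2 * g - 2) : ℝ) * bR g) / g *
        ∑ k ∈ Finset.Icc 2 g, A ^ (k - 1) / (Nat.factorial (k - 1) : ℝ) := by
        rw [Finset.mul_sum]
    _ ≤ 4 * ((Nat.factorial (2 * g - 2) : ℝ) * bR g) / g * Real.exp A := by gcongr
    _ = _ := by ring
end
end
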